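/- Let 1 ≤ n ≤ N, let α_n ∈ (0,1), set θ_n = α_n/2, and let α ∈ (0,1) satisfy α ≥ α_n/2. Then the coefficients are monotone: c_{0,n}^{(α)} ≥ c_{1,n}^{(α)} ≥ ⋯ ≥ c_{n−1,n}^{(α)} > 0. -/

import Mathlib

open Real MeasureTheory

/-- Graded mesh point `t_j = T (j/N)^r`. -/
noncomputable def gridT (T r : ℝ) (N j : ℕ) : ℝ := T * ((j : ℝ) / (N : ℝ)) ^ r

/-- Step size `τ_j = t_j - t_{j-1}`. -/
noncomputable def gridTau (T r : ℝ) (N j : ℕ) : ℝ := gridT T r N j - gridT T r N (j - 1)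

/-- Step-size ratio `ρ_j = τ_j / τ_{j+1}`. -/
noncomputable def gridRho (T r : ℝ) (N j : ℕ) : ℝ := gridTau T r N j / gridTau T r N (j + 1)

/-- Offset point `t_{n-θ} = θ t_{n-1} + (1-θ) t_n`. -/
noncomputable def tTheta (T r : ℝ) (N n : ℕ) (θ : ℝ) : ℝ :=
  θ * gridT T r N (n - 1) + (1 - θ) * gridT T r N n

/-- Coefficient `a_{n-k}^{(α)}`, parametrized by `k`. -/
noncomputable def coefA (T r : ℝ) (N n : ℕ) (θ α : ℝ) (k : ℕ) : ℝ :=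
  (1 / (gridTau T r N k * Real.Gamma (1 - α))) *
    ∫ s in (gridT T r N (k - 1))..(min (gridT T r N k) (tTheta T r N n θ)),
      (tTheta T r N n θ - s) ^ (-α)

/-- Coefficient `b_{n-k}^{(α)}`, parametrized by `k`. -/
noncomputable def coefB (T r : ℝ) (N n : ℕ) (θ α : ℝ) (k : ℕ) : ℝ :=
  (2 / (gridTau T r N k * (gridTau T r N k + gridTau T r N (k + 1)) * Real.Gamma (1 - α))) *
    ∫ s in (gridT T r N (k - 1))..(gridT T r N k),
      (s - (gridT T r N (k - 1) + gridT T r N k) / 2) * (tTheta T r N n θ - s) ^ (-α)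

/-- Coefficient `I_{n-k}^{(α)}`, parametrized by `k`. -/
noncomputable def coefI (T r : ℝ) (N n : ℕ) (θ α : ℝ) (k : ℕ) : ℝ :=
  (α / (Real.Gamma (1 - α) * gridTau T r N k)) *
    ∫ s in (gridT T r N (k - 1))..(gridT T r N k),
      (gridT T r N k - s) * (tTheta T r N n θ - s) ^ (-α - 1)

/-- Coefficient `J_{n-k}^{(α)}`, parametrized by `k`. -/
noncomputable def coefJ (T r : ℝ) (N n : ℕ) (θ α : ℝ) (k : ℕ) : ℝ :=
  (α / (Real.Gamma (1 - α) * gridTau T r N k)) *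
    ∫ s in (gridT T r N (k - 1))..(gridT T r N k),
      (s - gridT T r N (k - 1)) * (tTheta T r N n θ - s) ^ (-α - 1)

/-- Coefficient `c_{n-k,n}^{(α)}`, parametrized by `k` (`1 ≤ k ≤ n`). -/
noncomputable def coefC (T r : ℝ) (N n : ℕ) (θ α : ℝ) (k : ℕ) : ℝ :=
  if n = 1 then coefA T r N n θ α n
  else if k = n then coefA T r N n θ α n + gridRho T r N (n - 1) * coefB T r N n θ α (n - 1)
  else if k = 1 then coefA T r N n θ α 1 - coefB T r N n θ α 1
  else coefA T r N n θ α k + gridRho T r N (k - 1) * coefB T r N n θ α (k - 1)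
         - coefB T r N n θ α k

section MonotoneIntegrals

/-- The moment about the midpoint does not change when a constant is subtracted. -/
lemma integral_centered_mul_sub_const {f : ℝ → ℝ} {a b : ℝ}
    (hf : IntervalIntegrable f volume a b) (c : ℝ) :
    ∫ s in a..b, (s - (a + b) / 2) * (f s - c) = ∫ s in a..b, (s - (a + b) / 2) * f s := by
  have hcont : ContinuousOn (fun s : ℝ => s - (a + b) / 2) (Set.uIcc a b) := by fun_prop
  have hzero : ∫ s in a..b, (s - (a + b) / 2) * c = 0 := by
    rw [intervalIntegral.integral_mul_const, intervalIntegral.integral_sub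
      (by simp) (by simp), integral_id, intervalIntegral.integral_const, smul_eq_mul]
    ring
  simp_rw [mul_sub]
  rw [intervalIntegral.integral_sub (hf.continuousOn_mul hcont)
    (Continuous.intervalIntegrable (by fun_prop) _ _), hzero, sub_zero]

lemma integral_centered_mul_nonneg {f : ℝ → ℝ} {a b : ℝ} (hab : a ≤ b)
    (hf : MonotoneOn f (Set.Icc a b)) : 0 ≤ ∫ s in a..b, (s - (a + b) / 2) * f s := by
  have hint : IntervalIntegrable f volume a b :=
    MonotoneOn.intervalIntegrable (by rwa [Set.uIcc_of_le hab])
  rw [← integral_centered_mul_sub_const hint (f ((a + b) / 2))]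
  refine intervalIntegral.integral_nonneg hab fun s hs => ?_
  have hmid : (a + b) / 2 ∈ Set.Icc a b := ⟨by linarith, by linarith⟩
  rcases le_total s ((a + b) / 2) with h | h
  · exact mul_nonneg_of_nonpos_of_nonpos (by linarith) (sub_nonpos.2 (hf hs hmid h))
  · exact mul_nonneg (by linarith) (sub_nonneg.2 (hf hmid hs h))

lemma integral_centered_mul_le {f : ℝ → ℝ} {a b : ℝ} (hab : a ≤ b)
    (hf : MonotoneOn f (Set.Icc a b)) :
    ∫ s in a..b, (s - (a + b) / 2) * f s ≤
      (b - a) / 2 * ((∫ s in a..b, f s) - (b - a) * f a) := by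
  have hint : IntervalIntegrable f volume a b :=
    MonotoneOn.intervalIntegrable (by rwa [Set.uIcc_of_le hab])
  have hsub : IntervalIntegrable (fun s => f s - f a) volume a b := hint.sub (by simp)
  have hcont : ContinuousOn (fun s : ℝ => s - (a + b) / 2) (Set.uIcc a b) := by fun_prop
  have hmass : ∫ s in a..b, (b - a) / 2 * (f s - f a) =
      (b - a) / 2 * ((∫ s in a..b, f s) - (b - a) * f a) := by
    rw [intervalIntegral.integral_const_mul, intervalIntegral.integral_sub hint (by simp),
      intervalIntegral.integral_const, smul_eq_mul]
  rw [← integral_centered_mul_sub_const hint (f a), ← hmass]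
  refine intervalIntegral.integral_mono_on hab (hsub.continuousOn_mul hcont)
    (hsub.const_mul _) fun s hs => ?_
  have hfs : f a ≤ f s := hf ⟨le_rfl, hab⟩ hs hs.1
  exact mul_le_mul_of_nonneg_right (by linarith [hs.2]) (by linarith)

lemma mul_le_integral_of_monotoneOn {f : ℝ → ℝ} {a b : ℝ} (hab : a ≤ b)
    (hf : MonotoneOn f (Set.Icc a b)) : (b - a) * f a ≤ ∫ s in a..b, f s := by
  have hint : IntervalIntegrable f volume a b :=
    MonotoneOn.intervalIntegrable (by rwa [Set.uIcc_of_le hab])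
  have h := intervalIntegral.integral_mono_on hab (intervalIntegrable_const (c := f a)) hint
    fun s hs => hf ⟨le_rfl, hab⟩ hs hs.1
  simpa using h

lemma integral_centered_mul_le_of_slope_le {f : ℝ → ℝ} {a b m : ℝ} (hab : a ≤ b) (hm : 0 ≤ m)
    (hf : MonotoneOn f (Set.Icc a b)) (hslope : ∀ s ∈ Set.Icc a b, f b - f s ≤ m * (b - s)) :
    ∫ s in a..b, (s - (a + b) / 2) * f s ≤ m * (b - a) ^ 3 / 2 := by
  have hint : IntervalIntegrable f volume a b :=
    MonotoneOn.intervalIntegrable (by rwa [Set.uIcc_of_le hab])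
  have hsub : IntervalIntegrable (fun s => f s - f b) volume a b := hint.sub (by simp)
  have hcont : ContinuousOn (fun s : ℝ => s - (a + b) / 2) (Set.uIcc a b) := by fun_prop
  have hconst : ∫ _ in a..b, m * (b - a) ^ 2 / 2 = m * (b - a) ^ 3 / 2 := by
    rw [intervalIntegral.integral_const, smul_eq_mul]; ring
  rw [← integral_centered_mul_sub_const hint (f b), ← hconst]
  refine intervalIntegral.integral_mono_on hab (hsub.continuousOn_mul hcont)
    (by simp) fun s hs => ?_
  have hfs : f s ≤ f b := hf hs ⟨hab, le_rfl⟩ hs.2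
  have hbound : 0 ≤ m * (b - a) ^ 2 / 2 := by positivity
  rcases le_total ((a + b) / 2) s with h | h
  · exact (mul_nonpos_of_nonneg_of_nonpos (by linarith) (by linarith)).trans hbound
  · have hdrop : f b - f s ≤ m * (b - a) :=
      (hslope s hs).trans (mul_le_mul_of_nonneg_left (by linarith [hs.1]) hm)
    calc (s - (a + b) / 2) * (f s - f b) = ((a + b) / 2 - s) * (f b - f s) := by ring
      _ ≤ ((b - a) / 2) * (m * (b - a)) :=
        mul_le_mul (by linarith [hs.1]) hdrop (by linarith) (by linarith)
      _ = m * (b - a) ^ 2 / 2 := by ring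

lemma integral_le_of_le_slope {f : ℝ → ℝ} {a b m : ℝ} (hab : a ≤ b)
    (hf : MonotoneOn f (Set.Icc a b)) (hslope : ∀ s ∈ Set.Icc a b, m * (b - s) ≤ f b - f s) :
    ∫ s in a..b, f s ≤ (b - a) * f b - m * (b - a) ^ 2 / 2 := by
  have hint : IntervalIntegrable f volume a b :=
    MonotoneOn.intervalIntegrable (by rwa [Set.uIcc_of_le hab])
  have haffine : ∫ s in a..b, (f b - m * (b - s)) = (b - a) * f b - m * (b - a) ^ 2 / 2 := by
    rw [intervalIntegral.integral_sub (by simp) (Continuous.intervalIntegrable (by fun_prop) _ _),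
      intervalIntegral.integral_const_mul, intervalIntegral.integral_sub (by simp) (by simp),
      intervalIntegral.integral_const, intervalIntegral.integral_const, integral_id,
      smul_eq_mul, smul_eq_mul]
    ring
  rw [← haffine]
  exact intervalIntegral.integral_mono_on hab hint
    (Continuous.intervalIntegrable (by fun_prop) _ _) fun s hs => by linarith [hslope s hs]

end MonotoneIntegrals

section Kernel

variable {σ α : ℝ}

lemma monotoneOn_sub_rpow_neg (hα : 0 ≤ α) :
    MonotoneOn (fun s : ℝ => (σ - s) ^ (-α)) (Set.Iio σ) := fun _ _ y hy hxy =>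
  Real.rpow_le_rpow_of_nonpos (sub_pos.2 hy) (by linarith) (by linarith)

lemma hasDerivAt_sub_rpow_neg {x : ℝ} (hx : x < σ) :
    HasDerivAt (fun s : ℝ => (σ - s) ^ (-α)) (α * (σ - x) ^ (-α - 1)) x := by
  have h := ((hasDerivAt_id' x).const_sub σ).rpow_const (p := -α)
    (Or.inl (sub_pos.2 hx).ne')
  convert h using 1
  ring

lemma sub_rpow_neg_sub_le {s p : ℝ} (hα : 0 ≤ α) (hsp : s ≤ p) (hp : p < σ) :
    (σ - p) ^ (-α) - (σ - s) ^ (-α) ≤ α * (σ - p) ^ (-α - 1) * (p - s) := by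
  have hd : ∀ x ∈ Set.Iic p, HasDerivAt (fun s : ℝ => (σ - s) ^ (-α))
      (α * (σ - x) ^ (-α - 1)) x := fun x hx => hasDerivAt_sub_rpow_neg (lt_of_le_of_lt hx hp)
  refine (convex_Iic p).image_sub_le_mul_sub_of_deriv_le (f := fun s : ℝ => (σ - s) ^ (-α))
    (fun x hx => (hd x hx).continuousAt.continuousWithinAt)
    (fun x hx => (hd x (interior_subset hx)).differentiableAt.differentiableWithinAt)
    (fun x hx => ?_) s hsp p Set.self_mem_Iic hsp
  have hxp : x ≤ p := Set.mem_Iic.1 (interior_subset hx)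
  rw [(hd x hxp).deriv]
  exact mul_le_mul_of_nonneg_left
    (Real.rpow_le_rpow_of_nonpos (by linarith) (by linarith) (by linarith)) hα

lemma le_sub_rpow_neg_sub {p s q : ℝ} (hα : 0 ≤ α) (hps : p ≤ s) (hsq : s ≤ q) (hq : q < σ) :
    α * (σ - p) ^ (-α - 1) * (q - s) ≤ (σ - q) ^ (-α) - (σ - s) ^ (-α) := by
  have hd : ∀ x ∈ Set.Icc p q, HasDerivAt (fun s : ℝ => (σ - s) ^ (-α))
      (α * (σ - x) ^ (-α - 1)) x := fun x hx => hasDerivAt_sub_rpow_neg (hx.2.trans_lt hq)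
  refine (convex_Icc p q).mul_sub_le_image_sub_of_le_deriv (f := fun s : ℝ => (σ - s) ^ (-α))
    (fun x hx => (hd x hx).continuousAt.continuousWithinAt)
    (fun x hx => (hd x (interior_subset hx)).differentiableAt.differentiableWithinAt)
    (fun x hx => ?_) s ⟨hps, hsq⟩ q ⟨hps.trans hsq, le_rfl⟩ hsq
  have hxpq : x ∈ Set.Icc p q := interior_subset hx
  rw [(hd x hxpq).deriv]
  exact mul_le_mul_of_nonneg_left (Real.rpow_le_rpow_of_nonpos
    (by linarith [hxpq.2]) (by linarith [hxpq.1]) (by linarith)) hα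

lemma integral_sub_rpow_neg {p : ℝ} (hα : α < 1) (hp : p < σ) :
    ∫ s in p..σ, (σ - s) ^ (-α) = (σ - p) * (σ - p) ^ (-α) / (1 - α) := by
  have hpos : 0 < σ - p := sub_pos.2 hp
  rw [intervalIntegral.integral_comp_sub_left (fun x => x ^ (-α)), sub_self,
    integral_rpow (Or.inl (by linarith)), Real.zero_rpow (by linarith),
    Real.rpow_add hpos, Real.rpow_one, show -α + 1 = 1 - α by ring]
  ring

end Kernel

section Grid

variable {T r : ℝ} {N : ℕ}

lemma gridT_lt_succ (hT : 0 < T) (hr : 1 ≤ r) (hN : 1 ≤ N) (j : ℕ) :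
    gridT T r N j < gridT T r N (j + 1) := by
  have hN' : (0 : ℝ) < N := by exact_mod_cast hN
  refine mul_lt_mul_of_pos_left (Real.rpow_lt_rpow (by positivity) ?_ (by linarith)) hT
  exact div_lt_div_of_pos_right (by push_cast; linarith) hN'

lemma gridT_strictMono (hT : 0 < T) (hr : 1 ≤ r) (hN : 1 ≤ N) : StrictMono (gridT T r N) :=
  strictMono_nat_of_lt_succ (gridT_lt_succ hT hr hN)

lemma gridTau_succ (j : ℕ) : gridTau T r N (j + 1) = gridT T r N (j + 1) - gridT T r N j := rfl

lemma gridTau_succ_pos (hT : 0 < T) (hr : 1 ≤ r) (hN : 1 ≤ N) (j : ℕ) :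
    0 < gridTau T r N (j + 1) := sub_pos.2 (gridT_lt_succ hT hr hN j)

lemma gridTau_succ_le (hT : 0 < T) (hr : 1 ≤ r) (j : ℕ) :
    gridTau T r N (j + 1) ≤ gridTau T r N (j + 2) := by
  have h := (convexOn_rpow hr).2 (Set.mem_Ici.2 (show 0 ≤ (j : ℝ) / N by positivity))
    (Set.mem_Ici.2 (show 0 ≤ ((j + 2 : ℕ) : ℝ) / N by positivity))
    (show (0 : ℝ) ≤ 1 / 2 by norm_num) (show (0 : ℝ) ≤ 1 / 2 by norm_num) (by norm_num)
  have hmid : (1 / 2 : ℝ) • ((j : ℝ) / N) + (1 / 2 : ℝ) • (((j + 2 : ℕ) : ℝ) / N) =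
      ((j + 1 : ℕ) : ℝ) / N := by
    push_cast [smul_eq_mul]; ring
  rw [hmid] at h
  simp only [smul_eq_mul] at h
  have h' := mul_le_mul_of_nonneg_left h hT.le
  rw [gridTau_succ, show j + 2 = (j + 1) + 1 from rfl, gridTau_succ]
  unfold gridT
  linarith

lemma tTheta_succ_sub (n : ℕ) (θ : ℝ) :
    tTheta T r N (n + 1) θ - gridT T r N n = (1 - θ) * gridTau T r N (n + 1) := by
  rw [gridTau_succ, tTheta, Nat.add_sub_cancel]; ring

lemma gridT_lt_tTheta (hT : 0 < T) (hr : 1 ≤ r) (hN : 1 ≤ N) {n k : ℕ} {θ : ℝ} (hθ : θ < 1)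
    (hk : k < n) : gridT T r N k < tTheta T r N n θ := by
  obtain ⟨m, rfl⟩ : ∃ m, n = m + 1 := ⟨n - 1, by omega⟩
  have hm := (gridT_strictMono hT hr hN).monotone (show k ≤ m by omega)
  have hpos := mul_pos (sub_pos.2 hθ) (gridTau_succ_pos hT hr hN m)
  have := tTheta_succ_sub (T := T) (r := r) (N := N) m θ
  linarith

end Grid

section Coefficients

variable {T r : ℝ} {N n : ℕ} {θ α : ℝ}

lemma monotoneOn_kernel_Icc_gridT (hT : 0 < T) (hr : 1 ≤ r) (hN : 1 ≤ N) (hθ : θ < 1)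
    (hα : 0 ≤ α) {k : ℕ} (hk : k < n) (a : ℝ) :
    MonotoneOn (fun s => (tTheta T r N n θ - s) ^ (-α)) (Set.Icc a (gridT T r N k)) :=
  (monotoneOn_sub_rpow_neg hα).mono fun _ hs => hs.2.trans_lt (gridT_lt_tTheta hT hr hN hθ hk)

lemma coefA_succ_of_lt (hT : 0 < T) (hr : 1 ≤ r) (hN : 1 ≤ N) (hθ : θ < 1) {k : ℕ}
    (hk : k + 1 < n) :
    coefA T r N n θ α (k + 1) = (1 / (gridTau T r N (k + 1) * Real.Gamma (1 - α))) *
      ∫ s in (gridT T r N k)..(gridT T r N (k + 1)), (tTheta T r N n θ - s) ^ (-α) := by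
  rw [coefA, min_eq_left (gridT_lt_tTheta hT hr hN hθ hk).le, Nat.add_sub_cancel]

lemma coefB_succ_nonneg (hT : 0 < T) (hr : 1 ≤ r) (hN : 1 ≤ N) (hθ : θ < 1) (hα0 : 0 ≤ α)
    (hα1 : α < 1) {k : ℕ} (hk : k + 1 < n) : 0 ≤ coefB T r N n θ α (k + 1) := by
  have hG : 0 < Real.Gamma (1 - α) := Real.Gamma_pos_of_pos (by linarith)
  have h1 := gridTau_succ_pos hT hr hN k
  have h2 := gridTau_succ_pos hT hr hN (k + 1)
  exact mul_nonneg (by positivity) (integral_centered_mul_nonneg (gridT_lt_succ hT hr hN k).le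
    (monotoneOn_kernel_Icc_gridT hT hr hN hθ hα0 hk _))

lemma gridRho_mul_coefB_succ_nonneg (hT : 0 < T) (hr : 1 ≤ r) (hN : 1 ≤ N) (hθ : θ < 1)
    (hα0 : 0 ≤ α) (hα1 : α < 1) {k : ℕ} (hk : k + 1 < n) :
    0 ≤ gridRho T r N (k + 1) * coefB T r N n θ α (k + 1) :=
  mul_nonneg (div_nonneg (gridTau_succ_pos hT hr hN k).le (gridTau_succ_pos hT hr hN (k + 1)).le)
    (coefB_succ_nonneg hT hr hN hθ hα0 hα1 hk)

/-- The normalized kernel `(t_{n-θ} - t_k)^{-α} / Γ(1-α)`, which separates consecutive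
coefficients. -/
lemma kernel_le_coefA_sub_coefB (hT : 0 < T) (hr : 1 ≤ r) (hN : 1 ≤ N) (hθ : θ < 1)
    (hα0 : 0 ≤ α) (hα1 : α < 1) {k : ℕ} (hk : k + 1 < n) :
    (tTheta T r N n θ - gridT T r N k) ^ (-α) / Real.Gamma (1 - α) ≤
      coefA T r N n θ α (k + 1) - coefB T r N n θ α (k + 1) := by
  have hG : 0 < Real.Gamma (1 - α) := Real.Gamma_pos_of_pos (by linarith)
  have h1 := gridTau_succ_pos hT hr hN k
  have h2 := gridTau_succ_pos hT hr hN (k + 1)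
  have hle := (gridT_lt_succ hT hr hN k).le
  have hmono := monotoneOn_kernel_Icc_gridT hT hr hN hθ hα0 hk (gridT T r N k)
  have hmean := mul_le_integral_of_monotoneOn hle hmono
  have hmoment := integral_centered_mul_le hle hmono
  rw [coefA_succ_of_lt hT hr hN hθ hk, coefB, Nat.add_sub_cancel]
  rw [← gridTau_succ] at hmean hmoment
  generalize gridTau T r N (k + 1) = τ at *
  generalize gridTau T r N (k + 1 + 1) = τ' at *
  generalize Real.Gamma (1 - α) = G at *
  set A := ∫ s in (gridT T r N k)..(gridT T r N (k + 1)), (tTheta T r N n θ - s) ^ (-α)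
  set B := ∫ s in (gridT T r N k)..(gridT T r N (k + 1)),
      (s - (gridT T r N k + gridT T r N (k + 1)) / 2) * (tTheta T r N n θ - s) ^ (-α)
  set w := (tTheta T r N n θ - gridT T r N k) ^ (-α)
  have hdiff : 1 / (τ * G) * A - 2 / (τ * (τ + τ') * G) * B - w / G =
      ((τ + τ') * (A - τ * w) - 2 * B) / (τ * (τ + τ') * G) := by
    field_simp
    ring
  have hnonneg : 0 ≤ ((τ + τ') * (A - τ * w) - 2 * B) / (τ * (τ + τ') * G) := by
    refine div_nonneg ?_ (by positivity)
    nlinarith [mul_nonneg h2.le (sub_nonneg.2 hmean)]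
  linarith

lemma kernel_le_coefA_self (hT : 0 < T) (hr : 1 ≤ r) (hN : 1 ≤ N) (hθ0 : 0 ≤ θ) (hθα : θ ≤ α)
    (hα1 : α < 1) :
    (tTheta T r N (n + 1) θ - gridT T r N n) ^ (-α) / Real.Gamma (1 - α) ≤
      coefA T r N (n + 1) θ α (n + 1) := by
  have hG : 0 < Real.Gamma (1 - α) := Real.Gamma_pos_of_pos (by linarith)
  have h1 := gridTau_succ_pos hT hr hN n
  have hlt := gridT_lt_tTheta hT hr hN (hθα.trans_lt hα1) n.lt_succ_self
  have hend : tTheta T r N (n + 1) θ ≤ gridT T r N (n + 1) := by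
    have := tTheta_succ_sub (T := T) (r := r) (N := N) n θ
    nlinarith [gridTau_succ (T := T) (r := r) (N := N) n]
  rw [coefA, min_eq_right hend, Nat.add_sub_cancel, integral_sub_rpow_neg hα1 hlt]
  have hw : 0 < (tTheta T r N (n + 1) θ - gridT T r N n) ^ (-α) :=
    Real.rpow_pos_of_pos (sub_pos.2 hlt) _
  set w := (tTheta T r N (n + 1) θ - gridT T r N n) ^ (-α)
  rw [tTheta_succ_sub]
  have hα : 0 < 1 - α := by linarith
  have hratio : 1 ≤ (1 - θ) / (1 - α) := (one_le_div hα).2 (by linarith)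
  calc w / Real.Gamma (1 - α) ≤ w / Real.Gamma (1 - α) * ((1 - θ) / (1 - α)) :=
        le_mul_of_one_le_right (by positivity) hratio
    _ = _ := by field_simp

lemma coefA_le_kernel (hT : 0 < T) (hr : 1 ≤ r) (hN : 1 ≤ N) (hθ : θ < 1)
    (hα0 : 0 ≤ α) (hα1 : α < 1) {k : ℕ} (hk : k + 1 < n) :
    coefA T r N n θ α (k + 1) ≤
      (tTheta T r N n θ - gridT T r N (k + 1)) ^ (-α) / Real.Gamma (1 - α) := by
  have hG : 0 < Real.Gamma (1 - α) := Real.Gamma_pos_of_pos (by linarith)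
  have h1 := gridTau_succ_pos hT hr hN k
  have hle := (gridT_lt_succ hT hr hN k).le
  have hmono := monotoneOn_kernel_Icc_gridT hT hr hN hθ hα0 hk (gridT T r N k)
  have hmean := integral_le_of_le_slope (m := 0) hle hmono fun s hs => by
    simpa using hmono hs ⟨hle, le_rfl⟩ hs.2
  rw [← gridTau_succ] at hmean
  rw [coefA_succ_of_lt hT hr hN hθ hk, one_div_mul_eq_div, div_le_div_iff₀ (by positivity) hG]
  nlinarith

lemma coefA_add_le_kernel (hT : 0 < T) (hr : 1 ≤ r) (hN : 1 ≤ N) (hθ : θ < 1)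
    (hα0 : 0 ≤ α) (hα1 : α < 1) {k : ℕ} (hk : k + 2 < n) :
    coefA T r N n θ α (k + 2) + gridRho T r N (k + 1) * coefB T r N n θ α (k + 1) ≤
      (tTheta T r N n θ - gridT T r N (k + 2)) ^ (-α) / Real.Gamma (1 - α) := by
  have hG : 0 < Real.Gamma (1 - α) := Real.Gamma_pos_of_pos (by linarith)
  have hpσ := gridT_lt_tTheta hT hr hN hθ (show k + 1 < n by omega)
  have hqσ := gridT_lt_tTheta hT hr hN hθ hk
  have hm : 0 ≤ α * (tTheta T r N n θ - gridT T r N (k + 1)) ^ (-α - 1) :=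
    mul_nonneg hα0 (Real.rpow_nonneg (sub_pos.2 hpσ).le _)
  have h1 := gridTau_succ_pos hT hr hN k
  have h2 := gridTau_succ_pos hT hr hN (k + 1)
  have h12 := gridTau_succ_le (N := N) hT hr k
  have hmean := integral_le_of_le_slope (gridT_lt_succ hT hr hN (k + 1)).le
    (monotoneOn_kernel_Icc_gridT hT hr hN hθ hα0 hk _)
    fun s hs => le_sub_rpow_neg_sub hα0 hs.1 hs.2 hqσ
  have hmoment := integral_centered_mul_le_of_slope_le (gridT_lt_succ hT hr hN k).le hm
    (monotoneOn_kernel_Icc_gridT hT hr hN hθ hα0 (show k + 1 < n by omega) _)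
    fun s hs => sub_rpow_neg_sub_le hα0 hs.2 hpσ
  rw [← gridTau_succ] at hmean hmoment
  rw [coefA_succ_of_lt hT hr hN hθ hk, coefB, gridRho, Nat.add_sub_cancel]
  change _ ≤ (tTheta T r N n θ - gridT T r N (k + 1 + 1)) ^ (-α) / _
  change gridTau T r N (k + 1) ≤ gridTau T r N (k + 1 + 1) at h12
  generalize gridTau T r N (k + 1) = τ at *
  generalize gridTau T r N (k + 1 + 1) = τ' at *
  generalize Real.Gamma (1 - α) = G at *
  set A := ∫ s in (gridT T r N (k + 1))..(gridT T r N (k + 1 + 1)),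
      (tTheta T r N n θ - s) ^ (-α)
  set B := ∫ s in (gridT T r N k)..(gridT T r N (k + 1)),
      (s - (gridT T r N k + gridT T r N (k + 1)) / 2) * (tTheta T r N n θ - s) ^ (-α)
  set w := (tTheta T r N n θ - gridT T r N (k + 1 + 1)) ^ (-α)
  set m := α * (tTheta T r N n θ - gridT T r N (k + 1)) ^ (-α - 1)
  have hdiff : w / G - (1 / (τ' * G) * A + τ / τ' * (2 / (τ * (τ + τ') * G) * B)) =
      ((τ + τ') * (τ' * w - A) - 2 * B) / (τ' * (τ + τ') * G) := by
    field_simp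
    ring
  have hnonneg : 0 ≤ ((τ + τ') * (τ' * w - A) - 2 * B) / (τ' * (τ + τ') * G) := by
    refine div_nonneg ?_ (by positivity)
    have hcube : 2 * τ ^ 3 ≤ (τ + τ') * τ' ^ 2 := by
      nlinarith [mul_le_mul h12 h12 h1.le h2.le, mul_nonneg h1.le (sub_nonneg.2 h12)]
    have hA : (τ + τ') * (m * τ' ^ 2 / 2) ≤ (τ + τ') * (τ' * w - A) :=
      mul_le_mul_of_nonneg_left (by linarith) (by linarith)
    linarith [mul_le_mul_of_nonneg_left hcube hm]
  linarith

lemma kernel_le_coefC_succ (hT : 0 < T) (hr : 1 ≤ r) (hN : 1 ≤ N) (hθ0 : 0 ≤ θ) (hθα : θ ≤ α)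
    (hα1 : α < 1) {k : ℕ} (hk : k < n) :
    (tTheta T r N n θ - gridT T r N k) ^ (-α) / Real.Gamma (1 - α) ≤
      coefC T r N n θ α (k + 1) := by
  have hα0 : 0 ≤ α := hθ0.trans hθα
  have hθ1 : θ < 1 := hθα.trans_lt hα1
  obtain ⟨n, rfl⟩ : ∃ m, n = m + 1 := ⟨n - 1, by omega⟩
  rcases (show k ≤ n by omega).eq_or_lt with rfl | hkn
  · have hself := kernel_le_coefA_self (n := k) hT hr hN hθ0 hθα hα1
    rcases k with _ | k
    · simpa [coefC] using hself
    · have hB := gridRho_mul_coefB_succ_nonneg hT hr hN hθ1 hα0 hα1 (Nat.lt_succ_self (k + 1))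
      simp only [coefC, Nat.add_sub_cancel, if_true, show k + 1 + 1 ≠ 1 by omega, if_false]
      linarith
  · have hAB := kernel_le_coefA_sub_coefB hT hr hN hθ1 hα0 hα1 (show k + 1 < n + 1 by omega)
    rcases k with _ | k
    · simpa [coefC, show n ≠ 0 by omega, show (0 : ℕ) ≠ n by omega] using hAB
    · have hB := gridRho_mul_coefB_succ_nonneg hT hr hN hθ1 hα0 hα1
        (show k + 1 < n + 1 by omega)
      simp only [coefC, Nat.add_sub_cancel, show n + 1 ≠ 1 by omega, if_false,
        show k + 1 + 1 ≠ n + 1 by omega, show k + 1 + 1 ≠ 1 by omega]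
      linarith

lemma coefC_succ_le_kernel (hT : 0 < T) (hr : 1 ≤ r) (hN : 1 ≤ N) (hθ1 : θ < 1) (hα0 : 0 ≤ α)
    (hα1 : α < 1) {k : ℕ} (hk : k + 1 < n) :
    coefC T r N n θ α (k + 1) ≤
      (tTheta T r N n θ - gridT T r N (k + 1)) ^ (-α) / Real.Gamma (1 - α) := by
  have hB := coefB_succ_nonneg hT hr hN hθ1 hα0 hα1 hk
  rcases k with _ | k
  · have hA := coefA_le_kernel hT hr hN hθ1 hα0 hα1 hk
    simp only [zero_add] at hA hB hk ⊢
    simp only [coefC, if_true, show n ≠ 1 by omega, if_false, show 1 ≠ n by omega]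
    linarith
  · have hA := coefA_add_le_kernel hT hr hN hθ1 hα0 hα1 hk
    simp only [coefC, Nat.add_sub_cancel, show n ≠ 1 by omega, if_false,
      show k + 1 + 1 ≠ n by omega, show k + 1 + 1 ≠ 1 by omega]
    linarith

end Coefficients

/-- For `1 ≤ n ≤ N`, `α_n ∈ (0,1)`, `θ_n = α_n/2` and `α ∈ (0,1)` with `α ≥ α_n/2`,
the coefficients are monotone: `c_{0,n}^{(α)} ≥ c_{1,n}^{(α)} ≥ ⋯ ≥ c_{n-1,n}^{(α)} > 0`. -/
theorem coefC_monotone (T r : ℝ) (N n : ℕ) (αn α : ℝ)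
    (hT : 0 < T) (hr : 1 ≤ r) (hN : 1 ≤ N) (hn1 : 1 ≤ n) (hnN : n ≤ N)
    (hαn0 : 0 < αn) (hαn1 : αn < 1) (hα0 : 0 < α) (hα1 : α < 1) (hααn : αn / 2 ≤ α) :
    (∀ k : ℕ, 1 ≤ k → k ≤ n - 1 →
      coefC T r N n (αn / 2) α k ≤ coefC T r N n (αn / 2) α (k + 1)) ∧
    0 < coefC T r N n (αn / 2) α 1 := by
  have hθ0 : 0 ≤ αn / 2 := by linarith
  have hθ1 : αn / 2 < 1 := by linarith
  refine ⟨fun k hk hkn => ?_, ?_⟩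
  · obtain ⟨j, rfl⟩ : ∃ j, k = j + 1 := ⟨k - 1, by omega⟩
    exact (coefC_succ_le_kernel hT hr hN hθ1 hα0.le hα1 (by omega)).trans
      (kernel_le_coefC_succ hT hr hN hθ0 hααn hα1 (by omega))
  · have hpos := gridT_lt_tTheta hT hr hN hθ1 (show 0 < n by omega)
    exact (div_pos (Real.rpow_pos_of_pos (sub_pos.2 hpos) _)
      (Real.Gamma_pos_of_pos (by linarith))).trans_le
      (kernel_le_coefC_succ hT hr hN hθ0 hααn hα1 (by omega))
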